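/- arXiv:1710.08107 — 4 statements merged into one kernel-verified Lean document; each statement's English description precedes it below -/
import Mathlib

section
/- Let G be a finite connected simple graph, let P = v_1 ... v_n be a walk in G, and let i < j be discrepancy indices of P. Then no vertex strictly between them on P lies on a shortest path between v_i and v_j: for every index k with i < k < j, d(v_i, v_k) + d(v_k, v_j) > d(v_i, v_j). -/
open SimpleGraph

theorem stmt_2 {V : Type*} [Fintype V] (G : SimpleGraph V) (hconn : G.Connected)
    (n : ℕ) (v : ℕ → V) (hwalk : ∀ i : ℕ, i + 1 < n → G.Adj (v i) (v (i + 1)))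
    (i j : ℕ) (hij : i < j) (hj : j < n)
    (hdisc : G.dist (v i) (v j) < j - i)
    (hmin : ∀ i' j' : ℕ, i' < j' → j' < n →
      G.dist (v i') (v j') < j' - i' → j - i ≤ j' - i') :
    ∀ k : ℕ, i < k → k < j →
      G.dist (v i) (v j) < G.dist (v i) (v k) + G.dist (v k) (v j) := by
  intro k hik hkj
  have hk_left : k - i ≤ G.dist (v i) (v k) := by
    by_contra! h
    have := hmin i k hik (hkj.trans hj) h
    omega
  have hk_right : j - k ≤ G.dist (v k) (v j) := by
    by_contra! h
    have := hmin k j hkj hj h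
    omega
  omega
end

section
/- Let G be a finite connected simple graph, let P = v_1 ... v_n be a walk in G, and let i < j be discrepancy indices of P. Then j - i <= d(v_i, v_j) + 2. -/
open SimpleGraph

theorem stmt_3 {V : Type*} [Fintype V] (G : SimpleGraph V) (hconn : G.Connected)
    (n : ℕ) (v : ℕ → V) (hwalk : ∀ i : ℕ, i + 1 < n → G.Adj (v i) (v (i + 1)))
    (i j : ℕ) (hij : i < j) (hj : j < n)
    (hdisc : G.dist (v i) (v j) < j - i)
    (hmin : ∀ i' j' : ℕ, i' < j' → j' < n →
      G.dist (v i') (v j') < j' - i' → j - i ≤ j' - i') :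
    j - i ≤ G.dist (v i) (v j) + 2 := by
  obtain ⟨k, rfl⟩ : ∃ k, j = k + 1 := ⟨j - 1, by omega⟩
  have hstep : G.dist (v (k + 1)) (v k) = 1 := dist_eq_one_iff_adj.mpr (hwalk k hj).symm
  have htri := hconn.dist_triangle (u := v i) (v := v (k + 1)) (w := v k)
  by_contra! h
  have := hmin i k (by omega) (by omega) (by omega)
  omega
end

section
/- Let G be a pseudo-modular finite connected simple graph and let P = v_1 ... v_n be a walk in G with n >= 4 such that the subwalk v_2 ... v_n is a shortest path from v_2 to v_n, the indices 1 and n are discrepancy indices of P, and v_1 != v_n. Set d = d(v_1, v_n). Then there exists a vertex x of G with d(v_1, x) <= 1, d(x, v_3) <= 1, and d(x, v_n) <= d - 1. -/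
open SimpleGraph

/-- `G` is pseudo-modular: any three pairwise intersecting disks have a common vertex. -/
def PseudoModular {V : Type*} (G : SimpleGraph V) : Prop :=
  ∀ (v₁ v₂ v₃ : V) (r₁ r₂ r₃ : ℕ),
    (∃ x, G.dist v₁ x ≤ r₁ ∧ G.dist v₂ x ≤ r₂) →
    (∃ x, G.dist v₁ x ≤ r₁ ∧ G.dist v₃ x ≤ r₃) →
    (∃ x, G.dist v₂ x ≤ r₂ ∧ G.dist v₃ x ≤ r₃) →
    ∃ x, G.dist v₁ x ≤ r₁ ∧ G.dist v₂ x ≤ r₂ ∧ G.dist v₃ x ≤ r₃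

theorem SimpleGraph.Connected.exists_dist_le_one_of_dist_le {V : Type*} {G : SimpleGraph V}
    (hconn : G.Connected) {u w : V} {d : ℕ} (hd : 1 ≤ d) (h : G.dist u w ≤ d) :
    ∃ x, G.dist u x ≤ 1 ∧ G.dist w x ≤ d - 1 := by
  obtain ⟨p, hp⟩ := hconn.exists_walk_length_eq_dist u w
  cases p with
  | nil => exact ⟨u, by simp, by simp⟩
  | cons hadj q =>
    refine ⟨_, (SimpleGraph.dist_eq_one_iff_adj.mpr hadj).le, ?_⟩
    rw [SimpleGraph.dist_comm]
    have := SimpleGraph.dist_le q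
    rw [SimpleGraph.Walk.length_cons] at hp
    omega

theorem SimpleGraph.Connected.dist_le_of_forall_adj {V : Type*} {G : SimpleGraph V}
    (hconn : G.Connected) {n : ℕ} {v : ℕ → V}
    (hwalk : ∀ i : ℕ, i + 1 < n → G.Adj (v i) (v (i + 1))) (i k : ℕ) (hk : i + k < n) :
    G.dist (v i) (v (i + k)) ≤ k := by
  induction k with
  | zero => simp
  | succ k ih =>
    have := SimpleGraph.dist_eq_one_iff_adj.mpr (hwalk (i + k) (by omega))
    have := hconn.dist_triangle (u := v i) (v := v (i + k)) (w := v (i + k + 1))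
    have := ih (by omega)
    rw [← Nat.add_assoc]
    omega

theorem stmt_5 {V : Type*} [Fintype V] (G : SimpleGraph V) (hconn : G.Connected)
    (hpm : PseudoModular G) (n : ℕ) (hn : 4 ≤ n) (v : ℕ → V)
    (hwalk : ∀ i : ℕ, i + 1 < n → G.Adj (v i) (v (i + 1)))
    (hsub : G.dist (v 1) (v (n - 1)) = n - 2)
    (hdisc : G.dist (v 0) (v (n - 1)) < n - 1)
    (hmin : ∀ i' j' : ℕ, i' < j' → j' < n →
      G.dist (v i') (v j') < j' - i' → n - 1 ≤ j' - i')
    (hne : v 0 ≠ v (n - 1)) :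
    ∃ x : V, G.dist (v 0) x ≤ 1 ∧ G.dist x (v 2) ≤ 1 ∧
      G.dist x (v (n - 1)) ≤ G.dist (v 0) (v (n - 1)) - 1 := by
  have hpos : 0 < G.dist (v 0) (v (n - 1)) := hconn.pos_dist_of_ne hne
  have h01 := SimpleGraph.dist_eq_one_iff_adj.mpr (hwalk 0 (by omega))
  have h12 := SimpleGraph.dist_eq_one_iff_adj.mpr (hwalk 1 (by omega))
  have h2 := hconn.dist_le_of_forall_adj hwalk 2 (n - 3) (by omega)
  rw [show 2 + (n - 3) = n - 1 by omega] at h2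
  have htri := hconn.dist_triangle (u := v 1) (v := v 0) (w := v (n - 1))
  rw [SimpleGraph.dist_comm] at h12
  rw [SimpleGraph.dist_comm (u := v 1) (v := v 0)] at htri
  simp only [Nat.zero_add, Nat.reduceAdd] at h01 h12
  obtain ⟨x, h₀, h₂, hx⟩ := hpm (v 0) (v 2) (v (n - 1)) 1 1 (G.dist (v 0) (v (n - 1)) - 1)
    ⟨v 1, h01.le, h12.le⟩ (hconn.exists_dist_le_one_of_dist_le hpos le_rfl)
    (hconn.exists_dist_le_one_of_dist_le hpos (by omega))
  exact ⟨x, h₀, by rwa [SimpleGraph.dist_comm], by rwa [SimpleGraph.dist_comm]⟩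
end

section
/- Let G be a finite connected simple graph and let P = v_1 ... v_n be a walk from s to t in G that is 2-optimal, i.e., d(v_i, v_{i+2}) = 2 for every index i with i + 2 <= n. Then every atomic 2-deformation of P is a walk from s to t with exactly the same number of vertices as P; in particular, no single atomic 2-deformation can shorten a 2-optimal walk. -/
open SimpleGraph

variable {V : Type*}

/-- `P` is a walk from `s` to `t` in `G`: a nonempty list of vertices starting at `s`,
ending at `t`, with consecutive vertices adjacent. -/
def IsWalkFrom (G : SimpleGraph V) (s t : V) (P : List V) : Prop :=
  P.head? = some s ∧ P.getLast? = some t ∧ P.Chain' G.Adj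

/-- `P` is a shortest path from `s` to `t` in `G`: a walk from `s` to `t` with exactly
`d(s,t) + 1` vertices. -/
def IsShortestPathFrom (G : SimpleGraph V) (s t : V) (P : List V) : Prop :=
  IsWalkFrom G s t P ∧ P.length = G.dist s t + 1

/-- `P'` is an atomic `δ`-deformation of `P`: `P = U₁ U₂ U₃`, `P' = U₁ U₂' U₃` with
`|U₂'| ≤ |U₂| ≤ δ - 1`. -/
def IsAtomicDeform (δ : ℕ) (P P' : List V) : Prop :=
  ∃ U₁ U₂ U₂' U₃ : List V, P = U₁ ++ U₂ ++ U₃ ∧ P' = U₁ ++ U₂' ++ U₃ ∧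
    U₂'.length ≤ U₂.length ∧ U₂.length ≤ δ - 1

/-- `P` is `δ`-deformable to `P'`: a finite sequence of atomic `δ`-deformations leads from
`P` to `P'`, all intermediate lists being walks from `s` to `t`. -/
def IsDeform (G : SimpleGraph V) (s t : V) (δ : ℕ) (P P' : List V) : Prop :=
  Relation.ReflTransGen (fun Q Q' => IsAtomicDeform δ Q Q' ∧ IsWalkFrom G s t Q') P P'

/-- Deleting one vertex of a walk whose vertices at distance two along the walk are at distance
two in the graph never gives a walk with the same endpoints. -/
theorem not_isWalkFrom_erase_vertex {V : Type*} {G : SimpleGraph V} {s t x : V} {A B : List V}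
    (hP : IsWalkFrom G s t (A ++ [x] ++ B))
    (hopt : ∀ i : ℕ, i + 2 < (A ++ [x] ++ B).length →
      G.dist ((A ++ [x] ++ B).getD i s) ((A ++ [x] ++ B).getD (i + 2) s) = 2) :
    ¬ IsWalkFrom G s t (A ++ B) := by
  intro hP'
  obtain ⟨hs, ht, hc⟩ := hP
  obtain ⟨hs', ht', hc'⟩ := hP'
  rcases List.eq_nil_or_concat A with rfl | ⟨A, a, rfl⟩
  · cases B with
    | nil => simp at hs'
    | cons b B =>
      simp only [List.nil_append, List.singleton_append, List.head?_cons, Option.some.injEq]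
        at hs hs'
      have hadj : G.Adj x b := (List.isChain_cons_cons.mp hc).1
      exact hadj.ne (hs.trans hs'.symm)
  · cases B with
    | nil =>
      simp only [List.concat_eq_append, List.append_nil, List.getLast?_append,
        List.getLast?_singleton, Option.some_or, Option.some.injEq] at ht ht'
      have hadj : G.Adj a x := by
        rw [List.append_nil] at hc
        exact (List.isChain_append.mp hc).2.2 a (by simp) x (by simp)
      exact hadj.ne (ht'.trans ht.symm)
    | cons b B =>
      have hadj : G.Adj a b := (List.isChain_append.mp hc').2.2 a (by simp) b (by simp)
      have h := hopt A.length (by simp)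
      simp [List.getD_eq_getElem?_getD, SimpleGraph.dist_eq_one_iff_adj.mpr hadj] at h

theorem stmt_17 {V : Type*} [Fintype V] (G : SimpleGraph V) (hconn : G.Connected)
    (s t : V) (P : List V) (hP : IsWalkFrom G s t P)
    (hopt : ∀ i : ℕ, i + 2 < P.length →
      G.dist (P.getD i s) (P.getD (i + 2) s) = 2) :
    ∀ P' : List V, IsWalkFrom G s t P' → IsAtomicDeform 2 P P' →
      P'.length = P.length := by
  rintro P' hP' ⟨A, U, U', B, rfl, rfl, hle, hU⟩
  by_contra hne
  simp only [List.length_append] at hne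
  obtain ⟨x, rfl⟩ := List.length_eq_one_iff.mp (show U.length = 1 by omega)
  obtain rfl := List.length_eq_zero_iff.mp
    (show U'.length = 0 by simp only [List.length_singleton] at hle hne; omega)
  exact not_isWalkFrom_erase_vertex hP hopt (by simpa using hP')
end
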